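/- Let n = (q^m−1)/(q−1) and let T be any set of t pairwise distinct coordinate positions of the Hamming code H_{(q,m)}. If t < q^{m−1}, then the shortened code (H_{(q,m)})_T has length n−t and dimension n−m−t, and every nonzero codeword of (H_{(q,m)})_T has Hamming weight at least 3. If t = q^{m−1} and T is the support of a codeword of weight q^{m−1} in the Simplex code H_{(q,m)}^⊥, then (H_{(q,m)})_T has length n−t and dimension n−m−t+1, and every nonzero codeword of (H_{(q,m)})_T has Hamming weight at least 3. -/

import Mathlib

open Finset

section Defs

variable {F : Type} [Field F]

/-- The dual of a linear code `C ⊆ F^ι` w.r.t. the standard inner product. -/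
def dualCode {ι : Type} [Fintype ι] (C : Submodule F (ι → F)) :
    Submodule F (ι → F) where
  carrier := {x | ∀ c ∈ C, ∑ i, x i * c i = 0}
  add_mem' := by
    intro a b ha hb c hc
    simp only [Set.mem_setOf_eq] at ha hb ⊢
    simp only [Pi.add_apply, add_mul, Finset.sum_add_distrib, ha c hc, hb c hc, add_zero]
  zero_mem' := by
    intro c hc
    simp
  smul_mem' := by
    intro r a ha c hc
    simp only [Set.mem_setOf_eq] at ha ⊢
    simp only [Pi.smul_apply, smul_eq_mul, mul_assoc, ← Finset.mul_sum, ha c hc, mul_zero]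

/-- The subcode of codewords vanishing on every coordinate in `T`. -/
def zeroOn {ι : Type} (T : Finset ι) : Submodule F (ι → F) where
  carrier := {x | ∀ i ∈ T, x i = 0}
  add_mem' := by
    intro a b ha hb i hi
    simp only [Set.mem_setOf_eq] at ha hb
    simp [Pi.add_apply, ha i hi, hb i hi]
  zero_mem' := by intro i _; simp
  smul_mem' := by
    intro r a ha i hi
    simp only [Set.mem_setOf_eq] at ha
    simp [Pi.smul_apply, ha i hi]

/-- Deleting the coordinates in `T`. -/
def restrictTo {ι : Type} (T : Finset ι) : (ι → F) →ₗ[F] ({i : ι // i ∉ T} → F) :=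
  LinearMap.funLeft F F Subtype.val

/-- The punctured code `C^T`: delete the coordinates in `T` from every codeword. -/
def puncturedCode {ι : Type} (C : Submodule F (ι → F)) (T : Finset ι) :
    Submodule F ({i : ι // i ∉ T} → F) :=
  C.map (restrictTo T)

/-- The shortened code `C_T`: take the codewords vanishing on `T`, then delete `T`. -/
def shortenedCode {ι : Type} (C : Submodule F (ι → F)) (T : Finset ι) :
    Submodule F ({i : ι // i ∉ T} → F) :=
  (C ⊓ zeroOn T).map (restrictTo T)

/-- The code `C` has minimum distance (exactly) `d`. -/
def IsMinDist {ι : Type} [Fintype ι] [DecidableEq F] (C : Submodule F (ι → F)) (d : ℕ) : Prop :=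
  (∃ c ∈ C, c ≠ 0 ∧ hammingNorm c = d) ∧ ∀ c ∈ C, c ≠ 0 → d ≤ hammingNorm c

/-- `A_k(C)`: the number of codewords of Hamming weight `k` in `C`. -/
noncomputable def weightCount {ι : Type} [Fintype ι] [DecidableEq F]
    (C : Submodule F (ι → F)) (k : ℕ) : ℕ :=
  Nat.card {c : ι → F // c ∈ C ∧ hammingNorm c = k}

/-- A monomial transformation: permute the coordinates and scale each coordinate. -/
def monomialMap {ι κ : Type} (σ : ι ≃ κ) (u : κ → F) : (ι → F) →ₗ[F] (κ → F) where
  toFun x := fun j => u j * x (σ.symm j)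
  map_add' a b := by
    funext j
    simp [Pi.add_apply, mul_add]
  map_smul' r a := by
    funext j
    simp only [Pi.smul_apply, smul_eq_mul, RingHom.id_apply]
    ring

/-- Monomial equivalence of linear codes. -/
def MonomiallyEquiv {ι κ : Type} (C : Submodule F (ι → F)) (D : Submodule F (κ → F)) : Prop :=
  ∃ (σ : ι ≃ κ) (u : κ → F), (∀ j, u j ≠ 0) ∧ D = C.map (monomialMap σ u)

/-- The syndrome map attached to a parity-check matrix with columns `v i`. -/
def checkMap {m n : ℕ} (v : Fin n → (Fin m → F)) : (Fin n → F) →ₗ[F] (Fin m → F) where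
  toFun x := fun j => ∑ i, x i * v i j
  map_add' a b := by
    funext j
    simp [Pi.add_apply, add_mul, Finset.sum_add_distrib]
  map_smul' r a := by
    funext j
    simp [Pi.smul_apply, Finset.mul_sum, mul_assoc]

/-- `v` lists exactly one nonzero vector from each one-dimensional subspace of `F^m`. -/
def IsHammingMatrix {m n : ℕ} (v : Fin n → (Fin m → F)) : Prop :=
  (∀ i, v i ≠ 0) ∧ ∀ w : Fin m → F, w ≠ 0 → ∃! i : Fin n, ∃ c : F, w = c • v i

/-- The Hamming code attached to a parity-check matrix whose columns are the `v i`. -/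
def hammingCode {m n : ℕ} (v : Fin n → (Fin m → F)) : Submodule F (Fin n → F) :=
  LinearMap.ker (checkMap v)

/-- The Simplex code: the dual of the Hamming code. -/
def simplexCode {m n : ℕ} (v : Fin n → (Fin m → F)) : Submodule F (Fin n → F) :=
  dualCode (hammingCode v)

end Defs


section Helpers

variable {F : Type} [Field F]

def synd {m n : ℕ} (v : Fin n → (Fin m → F)) (T : Finset (Fin n)) :
    ({i : Fin n // i ∉ T} → F) →ₗ[F] (Fin m → F) :=
  Fintype.linearCombination F (fun i : {i : Fin n // i ∉ T} => v i.1)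

theorem checkMap_eq {m n : ℕ} (v : Fin n → (Fin m → F)) (x : Fin n → F) :
    checkMap v x = ∑ i, x i • v i := by
  funext j
  simp [checkMap, Finset.sum_apply]

theorem checkMap_restrict {m n : ℕ} (v : Fin n → (Fin m → F)) (T : Finset (Fin n))
    (x : Fin n → F) (hx : ∀ i ∈ T, x i = 0) :
    checkMap v x = synd v T (restrictTo T x) := by
  rw [checkMap_eq]
  simp only [synd, Fintype.linearCombination_apply, restrictTo, LinearMap.funLeft_apply]
  rw [← Finset.sum_subtype (Finset.univ.filter (fun i => i ∉ T)) (by simp)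
    (fun i => x i • v i)]
  symm
  apply Finset.sum_subset (by simp)
  intro i _ hi
  have hi : i ∈ T := by simpa using hi
  rw [hx i hi, zero_smul]

theorem shortened_eq {m n : ℕ} (v : Fin n → (Fin m → F)) (T : Finset (Fin n)) :
    shortenedCode (hammingCode v) T = LinearMap.ker (synd v T) := by
  ext y
  simp only [shortenedCode, Submodule.mem_map, Submodule.mem_inf, LinearMap.mem_ker]
  constructor
  · rintro ⟨x, ⟨hx, hz⟩, rfl⟩
    rw [← checkMap_restrict v T x hz]
    exact hx
  · intro hy
    have hr : restrictTo T (fun i => if h : i ∉ T then y ⟨i, h⟩ else 0) = y := by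
      funext i
      simp [restrictTo, LinearMap.funLeft_apply, i.2]
    have hz : ∀ i ∈ T, (fun i => if h : i ∉ T then y ⟨i, h⟩ else 0) i = 0 := by
      intro i hi
      simp [hi]
    refine ⟨_, ⟨?_, hz⟩, hr⟩
    show checkMap v _ = 0
    rw [checkMap_restrict v T _ hz, hr, hy]

theorem synd_range {m n : ℕ} (v : Fin n → (Fin m → F)) (T : Finset (Fin n)) :
    LinearMap.range (synd v T) = Submodule.span F (v '' {i | i ∉ T}) := by
  rw [synd, Fintype.range_linearCombination]
  congr 1
  ext w
  simp

theorem card_compl' {n : ℕ} (T : Finset (Fin n)) :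
    Nat.card {i : Fin n // i ∉ T} = n - T.card := by
  simp [Nat.card_eq_fintype_card, Fintype.card_subtype_compl]

theorem short_finrank {m n : ℕ} (v : Fin n → (Fin m → F)) (T : Finset (Fin n)) :
    Module.finrank F (Submodule.span F (v '' {i | i ∉ T})) +
    Module.finrank F ↥(shortenedCode (hammingCode v) T) = n - T.card := by
  rw [shortened_eq, ← synd_range, LinearMap.finrank_range_add_finrank_ker,
    Module.finrank_fintype_fun_eq_card, ← Nat.card_eq_fintype_card, card_compl']

theorem short_weight [DecidableEq F] {m n : ℕ} (v : Fin n → (Fin m → F)) (hv : IsHammingMatrix v)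
    (T : Finset (Fin n)) :
    ∀ c ∈ shortenedCode (hammingCode v) T, c ≠ 0 → 3 ≤ hammingNorm c := by
  intro c hc h0
  rw [shortened_eq, LinearMap.mem_ker, synd, Fintype.linearCombination_apply] at hc
  have hs : ∑ i ∈ Finset.univ.filter (fun i => c i ≠ 0), c i • v i.1 = 0 := by
    rw [← hc]
    apply Finset.sum_subset (by simp)
    intro i _ hi
    have hi : c i = 0 := by simpa using hi
    rw [hi, zero_smul]
  have hpos : 0 < hammingNorm c := hammingNorm_pos_iff.2 h0
  by_contra hlt
  have h12 : hammingNorm c = 1 ∨ hammingNorm c = 2 := by omega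
  unfold hammingNorm at h12
  rcases h12 with h | h
  · obtain ⟨a, ha⟩ := Finset.card_eq_one.1 h
    have hca : c a ≠ 0 := by
      have : a ∈ Finset.univ.filter (fun i => c i ≠ 0) := by rw [ha]; simp
      simpa using this
    rw [ha, Finset.sum_singleton] at hs
    rcases smul_eq_zero.1 hs with h | h
    · exact hca h
    · exact hv.1 _ h
  · obtain ⟨a, b, hab, ha⟩ := Finset.card_eq_two.1 h
    have hca : c a ≠ 0 := by
      have : a ∈ Finset.univ.filter (fun i => c i ≠ 0) := by rw [ha]; simp
      simpa using this
    rw [ha, Finset.sum_pair hab] at hs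
    have e : v a.1 = (-(c a)⁻¹ * c b) • v b.1 := by
      have h2 : c b • v b.1 = - (c a • v a.1) := by
        rw [eq_neg_iff_add_eq_zero, add_comm]; exact hs
      rw [mul_smul, h2, smul_neg, neg_smul, neg_neg, smul_smul, inv_mul_cancel₀ hca, one_smul]
    obtain ⟨i, _, hu⟩ := hv.2 (v a.1) (hv.1 _)
    have h1 := hu a.1 ⟨1, by simp⟩
    have h2 := hu b.1 ⟨_, e⟩
    exact hab (Subtype.ext (h1.trans h2.symm))

theorem finrank_ker_dual {m : ℕ} (φ : Module.Dual F (Fin m → F)) (hφ : φ ≠ 0) :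
    Module.finrank F (LinearMap.ker φ) + 1 = m := by
  have h := Module.Dual.finrank_ker_add_one_of_ne_zero hφ
  simpa using h

theorem span_top [Fintype F] {m n : ℕ} (v : Fin n → (Fin m → F)) (hv : IsHammingMatrix v)
    (T : Finset (Fin n)) (hT : T.card < Fintype.card F ^ (m - 1)) :
    Submodule.span F (v '' {i | i ∉ T}) = ⊤ := by
  by_contra hne
  obtain ⟨φ, hφ, hker⟩ := Submodule.exists_le_ker_of_lt_top _ (lt_top_iff_ne_top.2 hne)
  have hvan : ∀ i, i ∉ T → φ (v i) = 0 := fun i hi =>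
    hker (Submodule.subset_span ⟨i, hi, rfl⟩)
  obtain ⟨w0, hw0⟩ := LinearMap.surjective hφ 1
  have hone : ∀ w : LinearMap.ker φ, φ (w.1 + w0) = 1 := by
    intro w
    have := w.2
    rw [LinearMap.mem_ker] at this
    rw [map_add, this, hw0, zero_add]
  have hex : ∀ w : LinearMap.ker φ, ∃ i : Fin n, ∃ c : F, w.1 + w0 = c • v i := by
    intro w
    refine (hv.2 (w.1 + w0) ?_).exists
    intro h
    have := hone w
    rw [h, map_zero] at this
    exact zero_ne_one this
  choose f c hf using hex
  have hc1 : ∀ w, c w * φ (v (f w)) = 1 := by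
    intro w
    rw [← smul_eq_mul, ← map_smul, ← hf, hone]
  have hfT : ∀ w, f w ∈ T := by
    intro w
    by_contra h
    have := hc1 w
    rw [hvan _ h, mul_zero] at this
    exact zero_ne_one this
  have hinj : Function.Injective (fun w => (⟨f w, hfT w⟩ : T)) := by
    intro w w' h
    have h : f w = f w' := congrArg Subtype.val h
    have e1 := hc1 w
    have e2 := hc1 w'
    rw [← h] at e2
    have hn : φ (v (f w)) ≠ 0 := right_ne_zero_of_mul_eq_one e1
    have hcc : c w = c w' := mul_right_cancel₀ hn (e1.trans e2.symm)
    apply Subtype.ext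
    have := hf w
    rw [hcc, h, ← hf w'] at this
    exact add_right_cancel this
  have hcard := Nat.card_le_card_of_injective _ hinj
  rw [Module.natCard_eq_pow_finrank (K := F)] at hcard
  have hk := finrank_ker_dual φ hφ
  have : Module.finrank F (LinearMap.ker φ) = m - 1 := by omega
  rw [this] at hcard
  simp only [Nat.card_eq_fintype_card, Fintype.card_coe] at hcard
  omega

theorem simplex_functional {m n : ℕ} (v : Fin n → (Fin m → F)) (c : Fin n → F)
    (hc : c ∈ simplexCode v) : ∃ φ : Module.Dual F (Fin m → F), ∀ i, c i = φ (v i) := by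
  let ψ : Module.Dual F (Fin n → F) := Fintype.linearCombination F c
  have hψ : ψ ∈ LinearMap.range (checkMap v).dualMap := by
    rw [LinearMap.range_dualMap_eq_dualAnnihilator_ker, Submodule.mem_dualAnnihilator]
    intro x hx
    have := hc x hx
    simp only [ψ, Fintype.linearCombination_apply, smul_eq_mul]
    rw [← this]
    exact Finset.sum_congr rfl fun i _ => mul_comm _ _
  obtain ⟨φ, hφ⟩ := hψ
  refine ⟨φ, fun i => ?_⟩
  have := congrArg (fun g => g (Pi.single i 1)) hφ
  simp only [LinearMap.dualMap_apply, checkMap_eq, ψ, Fintype.linearCombination_apply] at this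
  simpa [Pi.single_apply] using this.symm

theorem span_ker {m n : ℕ} (v : Fin n → (Fin m → F)) (hv : IsHammingMatrix v)
    (T : Finset (Fin n)) (φ : Module.Dual F (Fin m → F)) (hT : ∀ i, i ∈ T ↔ φ (v i) ≠ 0) :
    Submodule.span F (v '' {i | i ∉ T}) = LinearMap.ker φ := by
  apply le_antisymm
  · rw [Submodule.span_le]
    rintro _ ⟨i, hi, rfl⟩
    by_contra h
    exact hi ((hT i).2 h)
  · intro w hw
    by_cases h0 : w = 0
    · rw [h0]; exact zero_mem _
    obtain ⟨i, c, hi⟩ := (hv.2 w h0).exists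
    have hc : c ≠ 0 := by
      rintro rfl
      exact h0 (by simpa using hi)
    rw [LinearMap.mem_ker, hi, map_smul, smul_eq_mul] at hw
    rw [hi]
    refine Submodule.smul_mem _ _ (Submodule.subset_span ⟨i, ?_, rfl⟩)
    intro hiT
    exact (hT i).1 hiT ((mul_eq_zero.1 hw).resolve_left hc)

end Helpers

/-- Length and dimension of the shortened Hamming code `(H_{(q,m)})_T`: if `t < q^{m-1}`
then `(H_{(q,m)})_T` is an `[n-t, n-m-t]` code of minimum weight at least `3`; if
`T` is the support of a weight-`q^{m-1}` codeword of the Simplex code `H_{(q,m)}^⊥`,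
then `(H_{(q,m)})_T` is an `[n-t, n-m-t+1]` code of minimum weight at least `3`. -/
theorem statement12 {F : Type} [Field F] [Fintype F] [DecidableEq F] {m n : ℕ}
    (hq : n * (Fintype.card F - 1) = Fintype.card F ^ m - 1) (hm : 2 ≤ m)
    (v : Fin n → (Fin m → F)) (hv : IsHammingMatrix v) (T : Finset (Fin n)) :
    (T.card < Fintype.card F ^ (m - 1) →
      Nat.card {i : Fin n // i ∉ T} = n - T.card ∧
      Module.finrank F ↥(shortenedCode (hammingCode v) T) = n - m - T.card ∧
      ∀ c ∈ shortenedCode (hammingCode v) T, c ≠ 0 → 3 ≤ hammingNorm c) ∧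
    (∀ c ∈ simplexCode v, hammingNorm c = Fintype.card F ^ (m - 1) →
      (∀ i, i ∈ T ↔ c i ≠ 0) →
      Nat.card {i : Fin n // i ∉ T} = n - T.card ∧
      Module.finrank F ↥(shortenedCode (hammingCode v) T) = n + 1 - m - T.card ∧
      ∀ x ∈ shortenedCode (hammingCode v) T, x ≠ 0 → 3 ≤ hammingNorm x) := by
  refine ⟨fun hT => ⟨card_compl' T, ?_, short_weight v hv T⟩, fun c hc hw hs =>
    ⟨card_compl' T, ?_, short_weight v hv T⟩⟩
  · have h := short_finrank v T
    rw [span_top v hv T hT, finrank_top, Module.finrank_fin_fun] at h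
    omega
  · obtain ⟨φ, hφ⟩ := simplex_functional v c hc
    have h := short_finrank v T
    rw [span_ker v hv T φ (fun i => by rw [hs, hφ])] at h
    have hne : φ ≠ 0 := by
      rintro rfl
      have : c = 0 := by funext i; simp [hφ]
      rw [this, hammingNorm_zero] at hw
      exact (pow_pos (Fintype.card_pos (α := F)) (m - 1)).ne hw
    have hk := finrank_ker_dual φ hne
    omega
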